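/- arXiv:2008.12508 — 3 statements merged into one kernel-verified Lean document; each statement's English description precedes it below -/
import Mathlib

section
/- Let G be a finite bipartite graph with weight function w such that all edges of G have pairwise distinct weights (w is injective on E). Then the SeqBAP for G has a unique solution M, and M is also the unique solution to the LexBAP for G. -/
open Finset

variable {V : Type*} [Fintype V] [DecidableEq V]

/-- `M` is a matching: no vertex is incident to more than one edge of `M`. -/
def IsMatching (M : Finset (Sym2 V)) : Prop :=
  ∀ v : V, (M.filter (fun e => v ∈ e)).card ≤ 1

/-- `M` is a maximum cardinality matching of the graph with edge set `E`. -/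
def IsMCM (E M : Finset (Sym2 V)) : Prop :=
  M ⊆ E ∧ IsMatching M ∧ ∀ M' ⊆ E, IsMatching M' → M'.card ≤ M.card

/-- The cardinality of a maximum cardinality matching of `E`. -/
noncomputable def mcmCard (E : Finset (Sym2 V)) : ℕ :=
  sSup {k : ℕ | ∃ M ⊆ E, IsMatching M ∧ M.card = k}

/-- The largest weight of an edge of `M` (`max_{e ∈ M} w(e)`). -/
noncomputable def maxW (w : Sym2 V → ℝ) (M : Finset (Sym2 V)) : ℝ :=
  sSup (w '' (M : Set (Sym2 V)))

/-- The bottleneck weight `W(G) = min over MCMs M of max_{e ∈ M} w(e)`. -/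
noncomputable def botW (w : Sym2 V → ℝ) (E : Finset (Sym2 V)) : ℝ :=
  sInf (maxW w '' {M : Finset (Sym2 V) | IsMCM E M})

/-- `M` is a bottleneck assignment of `E`. -/
def IsBotAssignment (w : Sym2 V → ℝ) (E M : Finset (Sym2 V)) : Prop :=
  IsMCM E M ∧ maxW w M = botW w E

/-- Edge `e` has strictly positive price of absence in `E`. -/
def PosPrice (w : Sym2 V → ℝ) (E : Finset (Sym2 V)) (e : Sym2 V) : Prop :=
  mcmCard (E.erase e) < mcmCard E ∨ botW w E < botW w (E.erase e)

/-- The price of absence `P(G,e)` as an extended real (`⊤` if removing `e`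
reduces the MCM cardinality). -/
noncomputable def price (w : Sym2 V → ℝ) (E : Finset (Sym2 V)) (e : Sym2 V) : EReal :=
  if mcmCard (E.erase e) < mcmCard E then ⊤
  else ((botW w (E.erase e) - botW w E : ℝ) : EReal)

/-- `E` is the edge set of a bipartite graph on disjoint parts `A` and `B`. -/
def IsBipartiteOn (A B : Finset V) (E : Finset (Sym2 V)) : Prop :=
  Disjoint A B ∧ ∀ e ∈ E, ∃ a ∈ A, ∃ b ∈ B, e = s(a, b)

/-- `P` is a path between `x` and `y` all of whose edges lie in `E`. -/
def IsPathBetween (E P : Finset (Sym2 V)) (x y : V) : Prop :=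
  ∃ (l : ℕ) (v : Fin (l + 1) → V), 0 < l ∧ Function.Injective v ∧
    v 0 = x ∧ v (Fin.last l) = y ∧
    (∀ k : Fin l, s(v k.castSucc, v k.succ) ∈ E) ∧
    P = Finset.image (fun k : Fin l => s(v k.castSucc, v k.succ)) Finset.univ

/-- `P` is alternating relative to the matching `M`. -/
def IsAlternating (M P : Finset (Sym2 V)) : Prop :=
  ∀ v : V, ((P ∩ M).filter (fun e => v ∈ e)).card ≤ 1 ∧
    ((P \ M).filter (fun e => v ∈ e)).card ≤ 1

/-- Vertex `v` is free relative to the matching `M`. -/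
def IsFree (M : Finset (Sym2 V)) (v : V) : Prop := ∀ e ∈ M, v ∉ e

/-- `P` is an augmenting path relative to `M` contained in the edge set `E`. -/
def IsAugPath (E M P : Finset (Sym2 V)) : Prop :=
  ∃ x y : V, IsPathBetween E P x y ∧ IsAlternating M P ∧ IsFree M x ∧ IsFree M y

/-- The matching-sublevel set `ψ(G,M)`. -/
noncomputable def sublevel (w : Sym2 V → ℝ) (E M : Finset (Sym2 V)) : Finset (Sym2 V) :=
  E.filter (fun e => w e ≤ maxW w M)

/-- The strict matching-sublevel set `ψ_S(G,M)`. -/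
noncomputable def strictSublevel (w : Sym2 V → ℝ) (E M : Finset (Sym2 V)) : Finset (Sym2 V) :=
  E.filter (fun e => w e < maxW w M)

/-- `ec` is a critical bottleneck edge of `E` relative to the MCM `M`. -/
noncomputable def IsCritical (w : Sym2 V → ℝ) (E M : Finset (Sym2 V)) (ec : Sym2 V) : Prop :=
  ec ∈ M ∧ (∀ e ∈ M, w e ≤ w ec) ∧
  ¬ ∃ P, IsAugPath ((M ∪ strictSublevel w E M).erase ec) (M.erase ec) P

/-- The set `L(M)` of maximum-weight edges of `M`. -/
noncomputable def maxEdges (w : Sym2 V → ℝ) (M : Finset (Sym2 V)) : Finset (Sym2 V) :=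
  M.filter (fun e => ∀ e' ∈ M, w e' ≤ w e)

/-- The edge set of the subgraph of `E` induced by agent set `Ak` and task set `Bk`. -/
def induced (E : Finset (Sym2 V)) (Ak Bk : Finset V) : Finset (Sym2 V) :=
  E.filter (fun e => ∃ a ∈ Ak, ∃ b ∈ Bk, e = s(a, b))

/-- Witness data of a solution to the SeqBAP: selected edges `{i_k, j_k}`,
vertex sets `A^k`, `B^k` (0-indexed) and bottleneck assignments `M^k` of the
induced graphs `G^k`. -/
structure SeqBAPData (w : Sym2 V → ℝ) (A B : Finset V) (E : Finset (Sym2 V)) (n : ℕ) where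
  i : Fin n → V
  j : Fin n → V
  Ak : Fin n → Finset V
  Bk : Fin n → Finset V
  Mk : Fin n → Finset (Sym2 V)
  hij : ∀ k, i k ∈ A ∧ j k ∈ B
  hedsitinct : ∀ k l, s(i k, j k) = s(i l, j l) → k = l
  hA0 : ∀ h : 0 < n, Ak ⟨0, h⟩ = A
  hB0 : ∀ h : 0 < n, Bk ⟨0, h⟩ = B
  hAk : ∀ (k : ℕ) (h : k + 1 < n),
    Ak ⟨k + 1, h⟩ = (Ak ⟨k, by omega⟩).erase (i ⟨k, by omega⟩)
  hBk : ∀ (k : ℕ) (h : k + 1 < n),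
    Bk ⟨k + 1, h⟩ = (Bk ⟨k, by omega⟩).erase (j ⟨k, by omega⟩)
  hMk : ∀ k, IsBotAssignment w (induced E (Ak k) (Bk k)) (Mk k)
  hmaxedge : ∀ k, s(i k, j k) ∈ maxEdges w (Mk k)
  hprice : ∀ k, ∀ e ∈ maxEdges w (Mk k),
    price w (induced E (Ak k) (Bk k)) e ≤ price w (induced E (Ak k) (Bk k)) (s(i k, j k))

/-- `M` is a solution to the SeqBAP for the bipartite graph with parts `A`, `B`
and edge set `E`. -/
def IsSeqBAPSol (w : Sym2 V → ℝ) (A B : Finset V) (E M : Finset (Sym2 V)) : Prop :=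
  IsMCM E M ∧ ∃ (n : ℕ) (d : SeqBAPData w A B E n),
    M.card = n ∧ M = Finset.image (fun k => s(d.i k, d.j k)) Finset.univ

/-- The weights of `M` sorted in nonincreasing order (the tuple `T(M)`). -/
noncomputable def sortedW (w : Sym2 V → ℝ) (M : Finset (Sym2 V)) : List ℝ :=
  ((M.val.map w).sort (· ≤ ·)).reverse

/-- The `k`-th entry `T_k(M)` (0-indexed) of the sorted weight tuple. -/
noncomputable def Tk (w : Sym2 V → ℝ) (M : Finset (Sym2 V)) (k : ℕ) : ℝ :=
  (sortedW w M).getD k 0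

/-- `M` is a solution to the LexBAP for the graph with edge set `E`. -/
def IsLexBAPSol (w : Sym2 V → ℝ) (E M : Finset (Sym2 V)) : Prop :=
  IsMCM E M ∧ ∀ M', IsMCM E M' → sortedW w M' ≠ sortedW w M →
    ∃ k < M.card, Tk w M k < Tk w M' k ∧ ∀ l < k, Tk w M l = Tk w M' l


theorem aux_isMatching_iff (M : Finset (Sym2 V)) :
    IsMatching M ↔ ∀ e ∈ M, ∀ f ∈ M, ∀ v, v ∈ e → v ∈ f → e = f := by
  unfold IsMatching
  constructor
  · intro h e he f hf v hve hvf
    exact Finset.card_le_one.1 (h v) e (by simp [he, hve]) f (by simp [hf, hvf])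
  · intro h v
    rw [Finset.card_le_one]
    intro e he f hf
    simp only [Finset.mem_filter] at he hf
    exact h e he.1 f hf.1 v he.2 hf.2

theorem aux_le_maxW (w : Sym2 V → ℝ) (M : Finset (Sym2 V)) (e : Sym2 V) (he : e ∈ M) :
    w e ≤ maxW w M :=
  le_csSup ((M.finite_toSet.image w).bddAbove) ⟨e, he, rfl⟩

theorem aux_maxW_eq (w : Sym2 V → ℝ) (M : Finset (Sym2 V)) (e : Sym2 V)
    (he : e ∈ maxEdges w M) : maxW w M = w e := by
  simp only [maxEdges, Finset.mem_filter] at he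
  apply IsGreatest.csSup_eq
  refine ⟨⟨e, he.1, rfl⟩, ?_⟩
  rintro _ ⟨f, hf, rfl⟩
  exact he.2 f hf

theorem aux_seq_unique (A B : Finset V) (E : Finset (Sym2 V)) (w : Sym2 V → ℝ)
    (hAB : Disjoint A B)
    (hinj : ∀ e ∈ E, ∀ e' ∈ E, w e = w e' → e = e') (n : ℕ)
    (d d' : SeqBAPData w A B E n) (k : Fin n) : d.i k = d'.i k ∧ d.j k = d'.j k := by
  have step : ∀ k, d.Ak k = d'.Ak k → d.Bk k = d'.Bk k →
      d.i k = d'.i k ∧ d.j k = d'.j k := by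
    intro k hA hB
    have h1 := aux_maxW_eq w _ _ (d.hmaxedge k)
    have h2 := aux_maxW_eq w _ _ (d'.hmaxedge k)
    have b1 := d.hMk k
    have b2 := d'.hMk k
    have mem : ∀ d : SeqBAPData w A B E n, s(d.i k, d.j k) ∈ E := by
      intro d
      have := (d.hMk k).1.1 (Finset.mem_filter.1 (d.hmaxedge k)).1
      exact (Finset.mem_filter.1 this).1
    have hw : w s(d.i k, d.j k) = w s(d'.i k, d'.j k) := by
      rw [← h1, ← h2, b1.2, b2.2, hA, hB]
    have := hinj _ (mem d) _ (mem d') hw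
    rw [Sym2.eq_iff] at this
    rcases this with h | h
    · exact h
    · exfalso
      exact Finset.disjoint_left.1 hAB (d.hij k).1 (h.1 ▸ (d'.hij k).2)
  have main : ∀ (m : ℕ) (h : m < n), d.Ak ⟨m, h⟩ = d'.Ak ⟨m, h⟩ ∧ d.Bk ⟨m, h⟩ = d'.Bk ⟨m, h⟩ := by
    intro m
    induction m with
    | zero => intro h; rw [d.hA0, d'.hA0, d.hB0, d'.hB0]; exact ⟨rfl, rfl⟩
    | succ m ih =>
      intro h
      obtain ⟨ha, hb⟩ := ih (by omega)
      obtain ⟨hi, hj⟩ := step _ ha hb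
      rw [d.hAk, d'.hAk, d.hBk, d'.hBk, ha, hb, hi, hj]
      exact ⟨rfl, rfl⟩
  exact step k (main k k.2).1 (main k k.2).2

/-- Enumerate a finset of edges by decreasing weight. -/
theorem aux_enum (w : Sym2 V → ℝ) (M : Finset (Sym2 V))
    (hinj : ∀ e ∈ M, ∀ e' ∈ M, w e = w e' → e = e') :
    ∃ g : Fin M.card → Sym2 V, (∀ k, g k ∈ M) ∧ (∀ e ∈ M, ∃ k, g k = e) ∧
      ∀ k l, k < l → w (g l) < w (g k) := by
  have hc : (M.image w).card = M.card :=
    Finset.card_image_of_injOn (fun e he f hf h => hinj e he f hf h)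
  let f := (M.image w).orderEmbOfFin hc
  have hf : ∀ k, ∃ e ∈ M, w e = f k := fun k =>
    Finset.mem_image.1 (Finset.orderEmbOfFin_mem _ hc k)
  choose g hgM hgw using hf
  refine ⟨fun k => g (Fin.rev k), fun k => hgM _, ?_, ?_⟩
  · intro e he
    have : w e ∈ Set.range f := by
      rw [Finset.range_orderEmbOfFin]
      exact Finset.mem_coe.2 (Finset.mem_image_of_mem w he)
    obtain ⟨k, hk⟩ := this
    refine ⟨Fin.rev k, ?_⟩
    apply hinj _ (hgM _) _ he
    rw [hgw, Fin.rev_rev, hk]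
  · intro k l hkl
    rw [hgw, hgw]
    exact f.strictMono (Fin.rev_lt_rev.2 hkl)

theorem aux_sort_append (S U L : Finset ℝ) (h : S = U ∪ L) (hlt : ∀ x ∈ L, ∀ y ∈ U, x < y) :
    (S.val.sort (· ≤ ·)).reverse = (U.val.sort (· ≤ ·)).reverse ++ (L.val.sort (· ≤ ·)).reverse := by
  rw [← List.reverse_append]
  congr 1
  have hdis : Disjoint U L := by
    rw [Finset.disjoint_left]
    intro x hx hx'
    exact lt_irrefl _ (hlt x hx' x hx)
  apply List.Perm.eq_of_pairwise (le := (· ≤ ·))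
  · intro a b _ _ h1 h2
    exact le_antisymm h1 h2
  · exact Multiset.pairwise_sort _ _
  · rw [List.pairwise_append]
    refine ⟨Multiset.pairwise_sort _ _, Multiset.pairwise_sort _ _, ?_⟩
    intro a ha b hb
    exact (hlt a (by simpa using ha) b (by simpa using hb)).le
  · rw [← Multiset.coe_eq_coe, ← Multiset.coe_add]
    simp only [Multiset.sort_eq]
    rw [h, ← Finset.disjUnion_eq_union _ _ hdis, Finset.disjUnion_val, add_comm]

theorem aux_lex (S T : Finset ℝ) (hc : S.card = T.card) (hlt : toColex S < toColex T) :
    ∃ k < S.card, (S.val.sort (· ≤ ·)).reverse.getD k 0 < (T.val.sort (· ≤ ·)).reverse.getD k 0 ∧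
      ∀ l < k, (S.val.sort (· ≤ ·)).reverse.getD l 0 = (T.val.sort (· ≤ ·)).reverse.getD l 0 := by
  obtain ⟨hne, hmax⟩ := Finset.Colex.toColex_lt_toColex_iff_max'_mem.1 hlt
  set a := (symmDiff S T).max' (Finset.symmDiff_nonempty.2 hne) with ha
  have hmem : a ∈ symmDiff S T := Finset.max'_mem _ _
  have haS : a ∉ S := by
    rw [Finset.mem_symmDiff] at hmem
    tauto
  have hagree : ∀ x, a < x → (x ∈ S ↔ x ∈ T) := by
    intro x hx
    by_contra hcon
    have : x ∈ symmDiff S T := by rw [Finset.mem_symmDiff]; tauto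
    exact absurd (Finset.le_max' _ x this) (not_le.2 hx)
  let U := S.filter (fun x => a < x)
  let LS := S.filter (fun x => x < a)
  let LT := T.filter (fun x => x < a)
  have hS : S = U ∪ LS := by
    ext x
    simp only [U, LS, Finset.mem_union, Finset.mem_filter]
    constructor
    · intro hx
      rcases lt_trichotomy a x with h | h | h
      · exact Or.inl ⟨hx, h⟩
      · subst h; exact absurd hx haS
      · exact Or.inr ⟨hx, h⟩
    · tauto
  have hT : T = U ∪ (insert a LT) := by
    ext x
    simp only [U, LT, Finset.mem_union, Finset.mem_filter, Finset.mem_insert]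
    constructor
    · intro hx
      rcases lt_trichotomy a x with h | h | h
      · exact Or.inl ⟨(hagree x h).2 hx, h⟩
      · exact Or.inr (Or.inl h.symm)
      · exact Or.inr (Or.inr ⟨hx, h⟩)
    · rintro (h | h | h)
      · exact (hagree x h.2).1 h.1
      · rw [h]; exact hmax
      · exact h.1
  have e1 := aux_sort_append S U LS hS (by
    intro x hx y hy
    exact (Finset.mem_filter.1 hx).2.trans (Finset.mem_filter.1 hy).2)
  have e2 := aux_sort_append T U (insert a LT) hT (by
    intro x hx y hy
    have hy := (Finset.mem_filter.1 hy).2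
    rcases Finset.mem_insert.1 hx with h | h
    · rw [h]; exact hy
    · exact (Finset.mem_filter.1 h).2.trans hy)
  have e3 := aux_sort_append (insert a LT) {a} LT (by rw [Finset.insert_eq]) (by
    intro x hx y hy
    rw [Finset.mem_singleton.1 hy]
    exact (Finset.mem_filter.1 hx).2)
  have hUT : U.card < T.card := by
    apply Finset.card_lt_card
    rw [Finset.ssubset_iff_of_subset (by rw [hT]; exact Finset.subset_union_left)]
    exact ⟨a, hmax, by simp [U, haS]⟩
  have hLS : LS.Nonempty := by
    rw [Finset.nonempty_iff_ne_empty]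
    intro h0
    rw [h0, Finset.union_empty] at hS
    rw [← hS] at hUT
    omega
  have hlen : (U.val.sort (· ≤ ·)).reverse.length = U.card := by simp
  refine ⟨U.card, by omega, ?_, ?_⟩
  · rw [e1, e2, e3, List.getD_append_right _ _ _ _ (by rw [hlen]),
      List.getD_append_right _ _ _ _ (by rw [hlen]), hlen, Nat.sub_self]
    have hr : (((({a} : Finset ℝ).val.sort (· ≤ ·)).reverse ++
      (LT.val.sort (· ≤ ·)).reverse).getD 0 0) = a := by simp
    rw [hr]
    have hpos : 0 < (LS.val.sort (· ≤ ·)).reverse.length := by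
      simpa using hLS.card_pos
    rw [List.getD_eq_getElem _ _ hpos]
    have : (LS.val.sort (· ≤ ·)).reverse[0] ∈ LS := by
      have h0 := List.getElem_mem hpos
      rw [List.mem_reverse, Multiset.mem_sort] at h0
      exact h0
    exact (Finset.mem_filter.1 this).2
  · intro l hl
    rw [e1, e2, List.getD_append _ _ _ _ (by rw [hlen]; exact hl),
      List.getD_append _ _ _ _ (by rw [hlen]; exact hl)]

theorem aux_sortedW (w : Sym2 V → ℝ) (M : Finset (Sym2 V))
    (hinj : ∀ e ∈ M, ∀ e' ∈ M, w e = w e' → e = e') :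
    sortedW w M = ((M.image w).val.sort (· ≤ ·)).reverse := by
  unfold sortedW
  rw [Finset.image_val_of_injOn (fun e he f hf h => hinj e he f hf h)]

theorem aux_exists_mcm (E : Finset (Sym2 V)) : ∃ M, IsMCM E M := by
  classical
  obtain ⟨M, hM, hmax⟩ := Finset.exists_max_image (E.powerset.filter (fun M => IsMatching M))
    Finset.card ⟨∅, Finset.mem_filter.2 ⟨by simp, fun v => by simp⟩⟩
  simp only [Finset.mem_filter, Finset.mem_powerset] at hM hmax
  exact ⟨M, hM.1, hM.2, fun M' h h' => hmax M' ⟨h, h'⟩⟩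

theorem aux_exists_data (A B : Finset V) (E : Finset (Sym2 V)) (w : Sym2 V → ℝ)
    (hbip : IsBipartiteOn A B E)
    (hinj : ∀ e ∈ E, ∀ e' ∈ E, w e = w e' → e = e')
    (M : Finset (Sym2 V)) (hM : IsMCM E M)
    (hmin : ∀ M', IsMCM E M' → toColex (M.image w) ≤ toColex (M'.image w)) :
    IsSeqBAPSol w A B E M := by
  obtain ⟨g, hgM, hgs, hgw⟩ := aux_enum w M
    (fun e he f hf h => hinj e (hM.1 he) f (hM.1 hf) h)
  have hmat := (aux_isMatching_iff M).1 hM.2.1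
  have hAB := Finset.disjoint_left.1 hbip.1
  have hginj : Function.Injective g := by
    intro k l hkl
    rcases lt_trichotomy k l with h | h | h
    · have := hgw _ _ h; rw [hkl] at this; exact absurd this (lt_irrefl _)
    · exact h
    · have := hgw _ _ h; rw [hkl] at this; exact absurd this (lt_irrefl _)
  have hex : ∀ k, ∃ i j, i ∈ A ∧ j ∈ B ∧ g k = s(i, j) := by
    intro k
    obtain ⟨a, ha, b, hb, h⟩ := hbip.2 _ (hM.1 (hgM k))
    exact ⟨a, b, ha, hb, h⟩
  choose i j hi hj hg using hex
  have hle : ∀ k l, k ≤ l → w (g l) ≤ w (g k) := by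
    intro k l h
    rcases h.eq_or_lt with h | h
    · rw [h]
    · exact (hgw _ _ h).le
  let Ak : Fin M.card → Finset V := fun k => A \ (Finset.univ.filter (fun l => l < k)).image i
  let Bk : Fin M.card → Finset V := fun k => B \ (Finset.univ.filter (fun l => l < k)).image j
  let Mk : Fin M.card → Finset (Sym2 V) := fun k => (Finset.univ.filter (fun l => k ≤ l)).image g
  let Pk : Fin M.card → Finset (Sym2 V) := fun k => (Finset.univ.filter (fun l => l < k)).image g
  have hMkM : ∀ k, Mk k ⊆ M := by
    intro k e he
    obtain ⟨l, _, rfl⟩ := Finset.mem_image.1 he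
    exact hgM l
  have hPkM : ∀ k, Pk k ⊆ M := by
    intro k e he
    obtain ⟨l, _, rfl⟩ := Finset.mem_image.1 he
    exact hgM l
  have hcard : ∀ k, (Mk k).card + (Pk k).card = M.card := by
    intro k
    rw [Finset.card_image_of_injective _ hginj, Finset.card_image_of_injective _ hginj]
    have := Finset.card_filter_add_card_filter_not (s := (Finset.univ : Finset (Fin M.card)))
      (fun l => k ≤ l)
    simpa [not_le] using this
  -- edges of the induced graph avoid the earlier edges
  have havoid : ∀ k, ∀ e ∈ induced E (Ak k) (Bk k), ∀ f ∈ Pk k, ∀ v, v ∈ e → v ∈ f → False := by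
    intro k e he f hf v hve hvf
    obtain ⟨l, hl, rfl⟩ := Finset.mem_image.1 hf
    obtain ⟨_, a, ha, b, hb, rfl⟩ := Finset.mem_filter.1 he
    have ha := Finset.mem_sdiff.1 ha
    have hb := Finset.mem_sdiff.1 hb
    have hil : i l ∈ (Finset.univ.filter (fun l => l < k)).image i :=
      Finset.mem_image_of_mem _ hl
    have hjl : j l ∈ (Finset.univ.filter (fun l => l < k)).image j :=
      Finset.mem_image_of_mem _ hl
    rw [hg] at hvf
    rw [Sym2.mem_iff] at hve hvf
    rcases hve with rfl | rfl <;> rcases hvf with h | h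
    · exact ha.2 (h ▸ hil)
    · exact hAB ha.1 (h ▸ hj l)
    · exact hAB (hi l) (h ▸ hb.1)
    · exact hb.2 (h ▸ hjl)
  have hdisj : ∀ k N, N ⊆ induced E (Ak k) (Bk k) → Disjoint N (Pk k) := by
    intro k N hN
    rw [Finset.disjoint_left]
    intro e he he'
    obtain ⟨l, hl, rfl⟩ := Finset.mem_image.1 he'
    exact havoid k _ (hN he) _ he' (i l) (by rw [hg]; simp) (by rw [hg]; simp)
  have hunion : ∀ k N, N ⊆ induced E (Ak k) (Bk k) → IsMatching N → N ∪ Pk k ⊆ E ∧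
      IsMatching (N ∪ Pk k) ∧ (N ∪ Pk k).card = N.card + (Pk k).card := by
    intro k N hN hNm
    refine ⟨?_, ?_, Finset.card_union_of_disjoint (hdisj k N hN)⟩
    · apply Finset.union_subset
      · exact hN.trans (Finset.filter_subset _ _)
      · exact (hPkM k).trans hM.1
    · rw [aux_isMatching_iff] at hNm ⊢
      intro e he f hf v hve hvf
      rcases Finset.mem_union.1 he with he | he <;> rcases Finset.mem_union.1 hf with hf | hf
      · exact hNm e he f hf v hve hvf
      · exact (havoid k e (hN he) f hf v hve hvf).elim
      · exact (havoid k f (hN hf) e he v hvf hve).elim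
      · exact hmat e (hPkM k he) f (hPkM k hf) v hve hvf
  have hMksub : ∀ k, Mk k ⊆ induced E (Ak k) (Bk k) := by
    intro k e he
    have heM := hMkM k he
    obtain ⟨l, hl, rfl⟩ := Finset.mem_image.1 he
    have hkl := (Finset.mem_filter.1 hl).2
    refine Finset.mem_filter.2 ⟨hM.1 heM, i l, ?_, j l, ?_, hg l⟩
    · refine Finset.mem_sdiff.2 ⟨hi l, ?_⟩
      intro h
      obtain ⟨m, hm, h⟩ := Finset.mem_image.1 h
      have hmk := (Finset.mem_filter.1 hm).2
      have := hginj (hmat _ (hgM m) _ (hgM l) (i l) (by rw [hg, h]; simp) (by rw [hg]; simp))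
      subst this
      exact absurd hkl (not_le.2 hmk)
    · refine Finset.mem_sdiff.2 ⟨hj l, ?_⟩
      intro h
      obtain ⟨m, hm, h⟩ := Finset.mem_image.1 h
      have hmk := (Finset.mem_filter.1 hm).2
      have := hginj (hmat _ (hgM m) _ (hgM l) (j l) (by rw [hg, h]; simp) (by rw [hg]; simp))
      subst this
      exact absurd hkl (not_le.2 hmk)
  have hMkmcm : ∀ k, IsMCM (induced E (Ak k) (Bk k)) (Mk k) := by
    intro k
    refine ⟨hMksub k, ?_, ?_⟩
    · rw [aux_isMatching_iff]
      exact fun e he f hf => hmat e (hMkM k he) f (hMkM k hf)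
    · intro N hN hNm
      obtain ⟨h1, h2, h3⟩ := hunion k N hN hNm
      have := hM.2.2 _ h1 h2
      have := hcard k
      omega
  have hgkMk : ∀ k, g k ∈ Mk k := fun k => Finset.mem_image_of_mem _ (by simp)
  have hmaxe : ∀ k, g k ∈ maxEdges w (Mk k) := by
    intro k
    refine Finset.mem_filter.2 ⟨hgkMk k, ?_⟩
    intro e he
    obtain ⟨l, hl, rfl⟩ := Finset.mem_image.1 he
    exact hle _ _ (Finset.mem_filter.1 hl).2
  have hbot : ∀ k, IsBotAssignment w (induced E (Ak k) (Bk k)) (Mk k) := by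
    intro k
    refine ⟨hMkmcm k, ?_⟩
    symm
    apply IsLeast.csInf_eq
    refine ⟨⟨Mk k, hMkmcm k, rfl⟩, ?_⟩
    rintro _ ⟨N, hN, rfl⟩
    rw [aux_maxW_eq w _ _ (hmaxe k)]
    by_contra hcon
    rw [not_le] at hcon
    have hN' : IsMCM (induced E (Ak k) (Bk k)) N := hN
    have hNlt : ∀ e ∈ N, w e < w (g k) := fun e he => (aux_le_maxW w N e he).trans_lt hcon
    obtain ⟨h1, h2, h3⟩ := hunion k N hN'.1 hN'.2.1
    have hNc : (Mk k).card ≤ N.card := hN'.2.2 _ (hMksub k) (hMkmcm k).2.1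
    have hmcm : IsMCM E (N ∪ Pk k) := by
      refine ⟨h1, h2, ?_⟩
      intro M' hs hm
      have := hM.2.2 M' hs hm
      have := hcard k
      omega
    have hlow := hmin _ hmcm
    have hlt : toColex ((N ∪ Pk k).image w) < toColex (M.image w) := by
      rw [Finset.Colex.toColex_lt_toColex_iff_exists_forall_lt]
      refine ⟨w (g k), Finset.mem_image_of_mem _ (hgM k), ?_, ?_⟩
      · intro h
        obtain ⟨e, he, hwe⟩ := Finset.mem_image.1 h
        rcases Finset.mem_union.1 he with he | he
        · exact (hNlt e he).ne hwe
        · obtain ⟨l, hl, rfl⟩ := Finset.mem_image.1 he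
          exact (hgw _ _ (Finset.mem_filter.1 hl).2).ne' hwe
      · intro b hb hbM
        obtain ⟨e, he, rfl⟩ := Finset.mem_image.1 hb
        rcases Finset.mem_union.1 he with he | he
        · exact hNlt e he
        · exact absurd (Finset.mem_image_of_mem w (hPkM k he)) hbM
    exact absurd hlt (not_lt.2 hlow)
  refine ⟨hM, M.card, ⟨i, j, Ak, Bk, Mk, fun k => ⟨hi k, hj k⟩, ?_, ?_, ?_, ?_, ?_, hbot, ?_, ?_⟩,
    rfl, ?_⟩
  · intro k l h
    rw [← hg, ← hg] at h
    exact hginj h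
  · intro h
    ext x
    simp only [Ak, Finset.mem_sdiff, Finset.mem_image, Finset.mem_filter, Finset.mem_univ,
      true_and, Fin.lt_def, Nat.not_lt_zero, false_and, exists_false, not_false_eq_true, and_true]
  · intro h
    ext x
    simp only [Bk, Finset.mem_sdiff, Finset.mem_image, Finset.mem_filter, Finset.mem_univ,
      true_and, Fin.lt_def, Nat.not_lt_zero, false_and, exists_false, not_false_eq_true, and_true]
  · intro k h
    ext x
    simp only [Ak, Finset.mem_sdiff, Finset.mem_image, Finset.mem_filter, Finset.mem_univ,
      true_and, Finset.mem_erase, Fin.lt_def]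
    constructor
    · rintro ⟨hx, hn⟩
      refine ⟨fun h' => hn ⟨_, Nat.lt_succ_self k, h'.symm⟩, hx, ?_⟩
      rintro ⟨l, hl, h'⟩
      exact hn ⟨l, by omega, h'⟩
    · rintro ⟨hne, hx, hn⟩
      refine ⟨hx, ?_⟩
      rintro ⟨l, hl, h'⟩
      rcases Nat.lt_succ_iff_lt_or_eq.1 hl with h2 | h2
      · exact hn ⟨l, h2, h'⟩
      · apply hne
        rw [← h']
        congr 1
        exact Fin.ext h2
  · intro k h
    ext x
    simp only [Bk, Finset.mem_sdiff, Finset.mem_image, Finset.mem_filter, Finset.mem_univ,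
      true_and, Finset.mem_erase, Fin.lt_def]
    constructor
    · rintro ⟨hx, hn⟩
      refine ⟨fun h' => hn ⟨_, Nat.lt_succ_self k, h'.symm⟩, hx, ?_⟩
      rintro ⟨l, hl, h'⟩
      exact hn ⟨l, by omega, h'⟩
    · rintro ⟨hne, hx, hn⟩
      refine ⟨hx, ?_⟩
      rintro ⟨l, hl, h'⟩
      rcases Nat.lt_succ_iff_lt_or_eq.1 hl with h2 | h2
      · exact hn ⟨l, h2, h'⟩
      · apply hne
        rw [← h']
        congr 1
        exact Fin.ext h2
  · intro k
    rw [← hg]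
    exact hmaxe k
  · intro k e he
    have h1 := aux_maxW_eq w _ _ he
    have h2 := aux_maxW_eq w _ _ (hmaxe k)
    have : e = g k := by
      apply hinj _ (hM.1 (hMkM k (Finset.mem_filter.1 he).1)) _ (hM.1 (hgM k))
      rw [← h1, ← h2]
    rw [this, ← hg]
  · ext e
    simp only [Finset.mem_image, Finset.mem_univ, true_and]
    constructor
    · intro he
      obtain ⟨k, hk⟩ := hgs e he
      exact ⟨k, by rw [← hg, hk]⟩
    · rintro ⟨k, rfl⟩
      rw [← hg]
      exact hgM k

/-- If all edge weights are pairwise distinct (w is injective on E), then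
the SeqBAP has a unique solution `M`, and `M` is also the unique solution to the
LexBAP. -/
theorem distinct_weights_unique_seqBAP_and_lexBAP
    (A B : Finset V) (E : Finset (Sym2 V)) (w : Sym2 V → ℝ)
    (hbip : IsBipartiteOn A B E)
    (hinj : ∀ e ∈ E, ∀ e' ∈ E, w e = w e' → e = e') :
    ∃ M : Finset (Sym2 V),
      IsSeqBAPSol w A B E M ∧
      (∀ M' : Finset (Sym2 V), IsSeqBAPSol w A B E M' → M' = M) ∧
      IsLexBAPSol w E M ∧
      (∀ M' : Finset (Sym2 V), IsLexBAPSol w E M' → M' = M) := by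
  classical
  obtain ⟨M, hM, hmin⟩ := Finset.exists_min_image
    ((Finset.univ : Finset (Finset (Sym2 V))).filter (fun M => IsMCM E M))
    (fun M => toColex (M.image w)) (by
      obtain ⟨M, hM⟩ := aux_exists_mcm E
      exact ⟨M, by simp [hM]⟩)
  simp only [Finset.mem_filter, Finset.mem_univ, true_and] at hM hmin
  have hI : ∀ M', IsMCM E M' → ∀ e ∈ M', ∀ e' ∈ M', w e = w e' → e = e' :=
    fun M' h e he e' he' => hinj e (h.1 he) e' (h.1 he')
  have hceq : ∀ M', IsMCM E M' → M'.card = M.card := fun M' h =>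
    le_antisymm (hM.2.2 _ h.1 h.2.1) (h.2.2 _ hM.1 hM.2.1)
  have hlt : ∀ M', IsMCM E M' → M' ≠ M → ∃ k < M.card, Tk w M k < Tk w M' k ∧
      ∀ l < k, Tk w M l = Tk w M' l := by
    intro M' h hne
    have hne' : M.image w ≠ M'.image w := by
      intro heq
      apply hne
      ext e
      constructor
      · intro he
        have := Finset.mem_image_of_mem w he
        rw [← heq] at this
        obtain ⟨f, hf, hw⟩ := Finset.mem_image.1 this
        rw [← hinj f (hM.1 hf) e (h.1 he) hw]
        exact hf
      · intro he
        have := Finset.mem_image_of_mem w he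
        rw [heq] at this
        obtain ⟨f, hf, hw⟩ := Finset.mem_image.1 this
        rw [← hinj f (h.1 hf) e (hM.1 he) hw]
        exact hf
    have hl : toColex (M.image w) < toColex (M'.image w) :=
      lt_of_le_of_ne (hmin M' h) (fun h => hne' (by simpa using h))
    have c1 : (M.image w).card = M.card := Finset.card_image_of_injOn (hI M hM)
    have c2 : (M'.image w).card = M'.card := Finset.card_image_of_injOn (hI M' h)
    have := aux_lex _ _ (by rw [c1, c2, hceq M' h]) hl
    rw [c1] at this
    unfold Tk
    rw [aux_sortedW w M (hI M hM), aux_sortedW w M' (hI M' h)]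
    exact this
  have hsol := aux_exists_data A B E w hbip hinj M hM hmin
  refine ⟨M, hsol, ?_, ⟨hM, ?_⟩, ?_⟩
  · rintro M' ⟨h, n', d', hn', hM'⟩
    obtain ⟨_, n, d, hn, hMd⟩ := hsol
    have : n' = n := by rw [← hn', ← hn, hceq M' h]
    subst this
    rw [hM', hMd]
    congr 1
    funext k
    obtain ⟨h1, h2⟩ := aux_seq_unique A B E w hbip.1 hinj _ d d' k
    rw [h1, h2]
  · intro M' h hs
    exact hlt M' h (fun h => hs (by rw [h]))
  · rintro M' ⟨h, hlex⟩
    by_contra hne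
    obtain ⟨k, hk, hkl, hke⟩ := hlt M' h hne
    obtain ⟨l, hl, hll, hle⟩ := hlex M hM (by
      intro heq
      unfold Tk at hkl
      rw [heq] at hkl
      exact lt_irrefl _ hkl)
    rcases lt_trichotomy k l with h1 | h1 | h1
    · rw [hle k h1] at hkl; exact lt_irrefl _ hkl
    · subst h1; exact lt_asymm hkl hll
    · rw [hke l h1] at hll; exact lt_irrefl _ hll
end

section
/- Let G = (V, E) be a finite bipartite graph with weight function w, let M be an MCM of G, and suppose there exists a critical bottleneck edge e_c of G relative to M. Then M is a bottleneck assignment of G, i.e., max_{e ∈ M} w(e) = W(G). -/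
open Finset

variable {V : Type*} [Fintype V] [DecidableEq V]

/-- A path of the graph spanned by `N ∪ K` between two distinct `N`-free vertices is augmenting. -/
lemma augPath_of_reachable (N K : Finset (Sym2 V)) (hN : IsMatching N) (hK : IsMatching K)
    (x y : V) (hxy : x ≠ y) (hx : IsFree N x) (hy : IsFree N y)
    (hr : (SimpleGraph.fromEdgeSet (↑(N ∪ K) : Set (Sym2 V))).Reachable x y) :
    ∃ P, IsAugPath (N ∪ K) N P := by
  obtain ⟨p, hp⟩ := hr.exists_isPath
  have hE : ∀ k : Fin p.length, s(p.getVert k.castSucc, p.getVert k.succ) ∈ N ∪ K := by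
    intro k
    have h := p.adj_getVert_succ k.2
    rw [SimpleGraph.fromEdgeSet_adj] at h
    exact_mod_cast h.1
  refine ⟨_, x, y, ⟨p.length, fun k => p.getVert k, ?_, ?_, ?_, ?_, hE, rfl⟩, ?_, hx, hy⟩
  · rcases Nat.eq_zero_or_pos p.length with h | h
    · exact absurd (SimpleGraph.Walk.eq_of_length_eq_zero h) hxy
    · exact h
  · intro a b hab
    exact Fin.ext (hp.getVert_injOn (Nat.lt_succ_iff.1 a.2) (Nat.lt_succ_iff.1 b.2) hab)
  · simp
  · simp
  · intro v
    constructor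
    · refine le_trans (Finset.card_le_card ?_) (hN v)
      exact Finset.filter_subset_filter _ Finset.inter_subset_right
    · refine le_trans (Finset.card_le_card ?_) (hK v)
      apply Finset.filter_subset_filter
      intro e he
      rw [Finset.mem_sdiff, Finset.mem_image] at he
      obtain ⟨⟨k, -, rfl⟩, h2⟩ := he
      exact (Finset.mem_union.1 (hE k)).resolve_left h2

lemma sum_incident (K : Finset (Sym2 V)) (hK : ∀ e ∈ K, ¬ e.IsDiag) :
    ∑ v : V, (K.filter (fun e => v ∈ e)).card = 2 * K.card := by
  have h := Finset.sum_card_bipartiteAbove_eq_sum_card_bipartiteBelow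
    (s := (Finset.univ : Finset V)) (t := K) (fun v e => v ∈ e)
  unfold Finset.bipartiteAbove Finset.bipartiteBelow at h
  rw [h, Finset.sum_congr rfl (g := fun _ => 2), Finset.sum_const, smul_eq_mul, mul_comm]
  intro e he
  rw [← Sym2.card_toFinset_of_not_isDiag e (hK e he)]
  congr 1
  ext v
  simp

/-- Berge's lemma. -/
lemma berge (N K : Finset (Sym2 V)) (hN : IsMatching N) (hK : IsMatching K)
    (hd : ∀ e ∈ N ∪ K, ¬ e.IsDiag) (hlt : N.card < K.card) :
    ∃ P, IsAugPath (N ∪ K) N P := by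
  classical
  by_contra hno
  set G := SimpleGraph.fromEdgeSet (↑(N ∪ K) : Set (Sym2 V)) with hG
  let c : Sym2 V → G.ConnectedComponent := fun e => G.connectedComponentMk (Quot.out e).1
  have hc : ∀ e ∈ N ∪ K, ∀ v ∈ e, c e = G.connectedComponentMk v := by
    intro e he v hv
    have h1 : (Quot.out e).1 ∈ e := Sym2.out_fst_mem e
    by_cases h : (Quot.out e).1 = v
    · simp only [c, h]
    · apply SimpleGraph.ConnectedComponent.sound
      apply SimpleGraph.Adj.reachable
      rw [hG, SimpleGraph.fromEdgeSet_adj]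
      refine ⟨?_, h⟩
      rw [← (Sym2.mem_and_mem_iff h).1 ⟨h1, hv⟩]
      exact_mod_cast he
  apply absurd hlt
  rw [not_lt, Finset.card_eq_sum_card_fiberwise (f := c) (t := Finset.univ) (s := K) (by simp),
    Finset.card_eq_sum_card_fiberwise (f := c) (t := Finset.univ) (s := N) (by simp)]
  apply Finset.sum_le_sum
  intro C _
  have sK := sum_incident (K.filter (fun e => c e = C))
    (fun e he => hd e (Finset.mem_union_right _ (Finset.mem_filter.1 he).1))
  have sN := sum_incident (N.filter (fun e => c e = C))
    (fun e he => hd e (Finset.mem_union_left _ (Finset.mem_filter.1 he).1))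
  have hfree : ((Finset.univ : Finset V).filter
      (fun v => G.connectedComponentMk v = C ∧ IsFree N v)).card ≤ 1 := by
    rw [Finset.card_le_one]
    intro x hx y hy
    simp only [Finset.mem_filter, Finset.mem_univ, true_and] at hx hy
    by_contra hxy
    exact hno (augPath_of_reachable N K hN hK x y hxy hx.2 hy.2
      (SimpleGraph.ConnectedComponent.exact (hx.1.trans hy.1.symm)))
  have hmain : ∑ v : V, ((K.filter (fun e => c e = C)).filter (fun e => v ∈ e)).card ≤
      ∑ v : V, (((N.filter (fun e => c e = C)).filter (fun e => v ∈ e)).card +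
        if G.connectedComponentMk v = C ∧ IsFree N v then 1 else 0) := by
    apply Finset.sum_le_sum
    intro v _
    by_cases hv : G.connectedComponentMk v = C
    · have h1 : ((K.filter (fun e => c e = C)).filter (fun e => v ∈ e)).card ≤ 1 :=
        le_trans (Finset.card_le_card
          (Finset.filter_subset_filter _ (Finset.filter_subset _ _))) (hK v)
      refine h1.trans ?_
      by_cases hf : IsFree N v
      · simp [hv, hf]
      · unfold IsFree at hf
        push Not at hf
        obtain ⟨e, he, hve⟩ := hf
        apply le_add_right
        rw [Nat.succ_le_iff, Finset.card_pos]
        refine ⟨e, ?_⟩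
        simp only [Finset.mem_filter]
        exact ⟨⟨he, (hc e (Finset.mem_union_left _ he) v hve).trans hv⟩, hve⟩
    · have h0 : (K.filter (fun e => c e = C)).filter (fun e => v ∈ e) = ∅ := by
        apply Finset.filter_eq_empty_iff.2
        intro e he hve
        rw [Finset.mem_filter] at he
        exact hv ((hc e (Finset.mem_union_right _ he.1) v hve).symm.trans he.2)
      rw [h0]
      simp
  rw [Finset.sum_add_distrib, ← Finset.card_filter, sK, sN] at hmain
  omega

theorem critical_edge_implies_bottleneck_assignment
    (A B : Finset V) (E : Finset (Sym2 V)) (w : Sym2 V → ℝ)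
    (hbip : IsBipartiteOn A B E)
    (M : Finset (Sym2 V)) (hMCM : IsMCM E M)
    (ec : Sym2 V) (hc : IsCritical w E M ec) :
    maxW w M = botW w E := by
  obtain ⟨hecM, hmax, hno⟩ := hc
  have hd : ∀ e ∈ E, ¬ e.IsDiag := by
    intro e he
    obtain ⟨a, ha, b, hb, rfl⟩ := hbip.2 e he
    rw [Sym2.mk_isDiag_iff]
    rintro rfl
    exact Finset.disjoint_left.1 hbip.1 ha hb
  unfold botW
  apply le_antisymm
  · apply le_csInf
    · exact ⟨_, M, hMCM, rfl⟩
    · rintro _ ⟨K, hK, rfl⟩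
      by_contra hlt
      rw [not_le] at hlt
      have hle : ∀ e ∈ K, w e < maxW w M := fun e he =>
        lt_of_le_of_lt (le_csSup ((Finset.finite_toSet K).image w).bddAbove
          ⟨e, he, rfl⟩) hlt
      have hMw : maxW w M ≤ w ec := by
        apply csSup_le
        · exact ⟨_, ec, hecM, rfl⟩
        · rintro _ ⟨e, he, rfl⟩
          exact hmax e he
      have hecK : ec ∉ K := fun h => absurd (hle ec h) (not_lt.2 hMw)
      have hNmat : IsMatching (M.erase ec) := fun v => le_trans (Finset.card_le_card
        (Finset.filter_subset_filter _ (Finset.erase_subset _ _))) (hMCM.2.1 v)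
      have hcard : (M.erase ec).card < K.card :=
        lt_of_lt_of_le (Finset.card_erase_lt_of_mem hecM) (hK.2.2 M hMCM.1 hMCM.2.1)
      obtain ⟨P, x, y, ⟨l, v, h0, h1, h2, h3, h4, h5⟩, h6⟩ :=
        berge (M.erase ec) K hNmat hK.2.1 (by
          intro e he
          rcases Finset.mem_union.1 he with h | h
          · exact hd e (hMCM.1 (Finset.mem_of_mem_erase h))
          · exact hd e (hK.1 h)) hcard
      refine hno ⟨P, x, y, ⟨l, v, h0, h1, h2, h3, fun k => ?_, h5⟩, h6⟩
      have hk := h4 k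
      generalize s(v k.castSucc, v k.succ) = e at hk
      rcases Finset.mem_union.1 hk with h | h
      · exact Finset.mem_erase.2 ⟨Finset.ne_of_mem_erase h,
          Finset.mem_union_left _ (Finset.mem_of_mem_erase h)⟩
      · refine Finset.mem_erase.2 ⟨fun h' => hecK (h' ▸ h), Finset.mem_union_right _ ?_⟩
        exact Finset.mem_filter.2 ⟨hK.1 h, hle e h⟩
  · exact csInf_le ((Set.toFinite _).image _).bddBelow ⟨M, hMCM, rfl⟩
end

section
/- Let G = (V, E) be a finite bipartite graph with weight function w, let M be a bottleneck assignment of G, and let e_p ∈ E. If there exists an augmenting path P' contained in ψ(G,M)\{e_p} relative to the matching M\{e_p}, then the symmetric difference M' := (M\{e_p}) ⊕ P' is a maximum cardinality matching of G that does not contain e_p, and every edge of M' has weight at most max_{e ∈ M} w(e). -/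
open Finset

variable {V : Type*} [Fintype V] [DecidableEq V]

theorem aux_card_le_one_iff (S : Finset (Sym2 V)) (u : V) :
    (S.filter (fun e => u ∈ e)).card ≤ 1 ↔
      ∀ a ∈ S, ∀ b ∈ S, u ∈ a → u ∈ b → a = b := by
  rw [Finset.card_le_one]
  constructor
  · intro h a ha b hb hua hub
    exact h a (by simp [ha, hua]) b (by simp [hb, hub])
  · intro h a ha b hb
    rw [Finset.mem_filter] at ha hb
    exact h a ha.1 b hb.1 ha.2 hb.2

/-- Augmenting a matching along an augmenting path. -/
theorem aux_augment (F N P : Finset (Sym2 V)) (hN : IsMatching N) (hP : IsAugPath F N P) :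
    P ⊆ F ∧ IsMatching ((N \ P) ∪ (P \ N)) ∧ N.card + 1 ≤ ((N \ P) ∪ (P \ N)).card := by
  obtain ⟨x, y, ⟨l, v, hl, hinj, hx, hy, hF, hPe⟩, halt, hfx, hfy⟩ := hP
  have hNm : ∀ u, ∀ a ∈ N, ∀ b ∈ N, u ∈ a → u ∈ b → a = b :=
    fun u => (aux_card_le_one_iff N u).1 (hN u)
  have hPm : ∀ u, ∀ a ∈ P \ N, ∀ b ∈ P \ N, u ∈ a → u ∈ b → a = b :=
    fun u => (aux_card_le_one_iff (P \ N) u).1 (halt u).2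
  -- pass to indices in `ℕ`
  obtain ⟨z, hz⟩ : ∃ z : ℕ → V, ∀ k (hk : k < l + 1), z k = v ⟨k, hk⟩ :=
    ⟨fun k => if hk : k < l + 1 then v ⟨k, hk⟩ else x, fun k hk => by simp [hk]⟩
  have hzinj : ∀ a b, a < l + 1 → b < l + 1 → z a = z b → a = b := by
    intro a b ha hb hab
    rw [hz a ha, hz b hb] at hab
    simpa using hinj hab
  have hz0 : z 0 = x := by rw [hz 0 (by omega), ← hx]; rfl
  have hzl : z l = y := by rw [hz l (by omega), ← hy]; rfl
  obtain ⟨f, hf⟩ : ∃ f : ℕ → Sym2 V, ∀ k, f k = s(z k, z (k + 1)) := ⟨_, fun _ => rfl⟩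
  have hfv : ∀ k : Fin l, s(v k.castSucc, v k.succ) = f k := by
    intro k
    rw [hf, hz k (by omega), hz (k + 1) (by omega)]
    rfl
  have hPf : ∀ e, e ∈ P ↔ ∃ k, k < l ∧ f k = e := by
    intro e
    rw [hPe, Finset.mem_image]
    constructor
    · rintro ⟨k, -, rfl⟩
      exact ⟨k, k.2, (hfv k).symm⟩
    · rintro ⟨k, hk, rfl⟩
      exact ⟨⟨k, hk⟩, Finset.mem_univ _, hfv ⟨k, hk⟩⟩
  have hmf : ∀ k, z k ∈ f k := fun k => by rw [hf]; simp
  have hmf' : ∀ k, z (k + 1) ∈ f k := fun k => by rw [hf]; simp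
  have hfinj : ∀ a b, a < l → b < l → f a = f b → a = b := by
    intro a b ha hb hab
    rw [hf, hf, Sym2.eq_iff] at hab
    rcases hab with ⟨h, -⟩ | ⟨h1, h2⟩
    · exact hzinj _ _ (by omega) (by omega) h
    · have := hzinj _ _ (by omega) (by omega) h1
      have := hzinj _ _ (by omega) (by omega) h2
      omega
  have hf0 : f 0 ∉ N := fun h => hfx _ h (hz0 ▸ hmf 0)
  have hflast : f (l - 1) ∉ N := fun h => hfy _ h (by
    have := hmf' (l - 1)
    rwa [Nat.sub_add_cancel hl, hzl] at this)
  refine ⟨?_, ?_, ?_⟩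
  · intro e he
    obtain ⟨k, hk, rfl⟩ := (hPf e).1 he
    rw [← hfv ⟨k, hk⟩]
    exact hF _
  · -- a vertex on `P` is not covered by `N \ P`
    have key : ∀ u, ∀ a ∈ N \ P, ∀ b ∈ P \ N, u ∈ a → u ∈ b → False := by
      intro u a ha b hb hua hub
      rw [Finset.mem_sdiff] at ha
      have hb' := Finset.mem_sdiff.1 hb
      obtain ⟨k, hk, rfl⟩ := (hPf b).1 hb'.1
      obtain ⟨j, hj, rfl⟩ : ∃ j, j < l + 1 ∧ u = z j := by
        rw [hf, Sym2.mem_iff] at hub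
        rcases hub with h | h
        · exact ⟨k, by omega, h⟩
        · exact ⟨k + 1, by omega, h⟩
      have hj0 : j ≠ 0 := by
        rintro rfl
        exact hfx a ha.1 (hz0 ▸ hua)
      have hjl : j ≠ l := by
        rintro rfl
        exact hfy a ha.1 (hzl ▸ hua)
      obtain ⟨i, rfl⟩ := Nat.exists_eq_succ_of_ne_zero hj0
      have h1 : f i ∈ P := (hPf _).2 ⟨i, by omega, rfl⟩
      have h2 : f (i + 1) ∈ P := (hPf _).2 ⟨i + 1, by omega, rfl⟩
      have n1 : f i ∉ N := fun h => ha.2 (hNm _ a ha.1 _ h hua (hmf' i) ▸ h1)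
      have n2 : f (i + 1) ∉ N := fun h => ha.2 (hNm _ a ha.1 _ h hua (hmf (i + 1)) ▸ h2)
      have := hPm _ _ (Finset.mem_sdiff.2 ⟨h1, n1⟩) _ (Finset.mem_sdiff.2 ⟨h2, n2⟩)
        (hmf' i) (hmf (i + 1))
      have := hfinj _ _ (by omega) (by omega) this
      omega
    intro u
    rw [aux_card_le_one_iff]
    intro a ha b hb hua hub
    rcases Finset.mem_union.1 ha with ha | ha <;> rcases Finset.mem_union.1 hb with hb | hb
    · exact hNm u a (Finset.mem_sdiff.1 ha).1 b (Finset.mem_sdiff.1 hb).1 hua hub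
    · exact (key u a ha b hb hua hub).elim
    · exact (key u b hb a ha hub hua).elim
    · exact hPm u a ha b hb hua hub
  · have hdisj : Disjoint (N \ P) (P \ N) := disjoint_sdiff_sdiff
    rw [Finset.card_union_of_disjoint hdisj]
    have h1 := Finset.card_sdiff_add_card_inter N P
    suffices h : (N ∩ P).card + 1 ≤ (P \ N).card by omega
    let S := (Finset.range l).filter (fun k => f k ∈ N)
    let T := (Finset.range l).filter (fun k => f k ∉ N)
    have hS : (N ∩ P) = S.image f := by
      ext e
      simp only [Finset.mem_inter, hPf, S, Finset.mem_image, Finset.mem_filter, Finset.mem_range]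
      constructor
      · rintro ⟨h, k, hk, rfl⟩
        exact ⟨k, ⟨hk, h⟩, rfl⟩
      · rintro ⟨k, ⟨hk, h⟩, rfl⟩
        exact ⟨h, k, hk, rfl⟩
    have hT : (T.image f) ⊆ P \ N := by
      intro e
      simp only [Finset.mem_sdiff, hPf, T, Finset.mem_image, Finset.mem_filter, Finset.mem_range]
      rintro ⟨k, ⟨hk, h⟩, rfl⟩
      exact ⟨⟨k, hk, rfl⟩, h⟩
    have hTc : (T.image f).card = T.card := by
      apply Finset.card_image_of_injOn
      intro a ha b hb hab
      simp only [T, Finset.coe_filter, Finset.mem_range, Set.mem_setOf_eq] at ha hb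
      exact hfinj a b ha.1 hb.1 hab
    have hSpos : ∀ k ∈ S, k < l ∧ f k ∈ N ∧ k ≠ 0 := by
      intro k hk
      simp only [S, Finset.mem_filter, Finset.mem_range] at hk
      refine ⟨hk.1, hk.2, ?_⟩
      rintro rfl
      exact hf0 hk.2
    have hSc : (S.image (fun k => k - 1)).card = S.card := by
      apply Finset.card_image_of_injOn
      intro a ha b hb hab
      have := hSpos a ha
      have := hSpos b hb
      simp only at hab
      omega
    have hnot : l - 1 ∉ S.image (fun k => k - 1) := by
      intro h
      obtain ⟨k, hk, hkl⟩ := Finset.mem_image.1 h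
      have := hSpos k hk
      omega
    have hsub : insert (l - 1) (S.image (fun k => k - 1)) ⊆ T := by
      intro j hj
      simp only [T, Finset.mem_filter, Finset.mem_range]
      rcases Finset.mem_insert.1 hj with rfl | hj
      · exact ⟨by omega, hflast⟩
      · obtain ⟨k, hk, rfl⟩ := Finset.mem_image.1 hj
        obtain ⟨hkl, hkN, hk0⟩ := hSpos k hk
        refine ⟨by omega, fun h => ?_⟩
        have hm := hmf' (k - 1)
        rw [Nat.sub_add_cancel (by omega)] at hm
        have := hfinj _ _ (by omega) hkl (hNm _ _ h _ hkN hm (hmf k))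
        omega
    have c1 := Finset.card_le_card hsub
    rw [Finset.card_insert_of_notMem hnot, hSc] at c1
    have c2 := Finset.card_le_card hT
    have c3 : (N ∩ P).card ≤ S.card := hS ▸ Finset.card_image_le
    omega

/-- If `P'` is an augmenting path contained in `ψ(G,M) \ {e_p}` relative to
the matching `M \ {e_p}`, then `M' = (M \ {e_p}) ⊕ P'` is an MCM of `G` not containing
`e_p`, and every edge of `M'` has weight at most `max_{e ∈ M} w(e)`. -/
theorem augPath_symmDiff_is_MCM
    (A B : Finset V) (E : Finset (Sym2 V)) (w : Sym2 V → ℝ)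
    (hbip : IsBipartiteOn A B E)
    (M : Finset (Sym2 V)) (hM : IsBotAssignment w E M)
    (ep : Sym2 V) (hep : ep ∈ E)
    (P' : Finset (Sym2 V))
    (hP : IsAugPath ((sublevel w E M).erase ep) (M.erase ep) P') :
    IsMCM E ((M.erase ep \ P') ∪ (P' \ M.erase ep)) ∧
      ep ∉ (M.erase ep \ P') ∪ (P' \ M.erase ep) ∧
      ∀ e ∈ (M.erase ep \ P') ∪ (P' \ M.erase ep), w e ≤ maxW w M := by
  obtain ⟨⟨hME, hMm, hmax⟩, -⟩ := hM
  have hNm : IsMatching (M.erase ep) := by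
    intro u
    exact (Finset.card_le_card (Finset.filter_subset_filter _ (Finset.erase_subset _ _))).trans
      (hMm u)
  obtain ⟨hsub, hmat, hcard⟩ := aux_augment _ _ _ hNm hP
  have hPe : ∀ e ∈ P', e ≠ ep ∧ e ∈ E ∧ w e ≤ maxW w M := by
    intro e he
    have := hsub he
    rw [Finset.mem_erase, sublevel, Finset.mem_filter] at this
    exact this
  have hall : ∀ e ∈ (M.erase ep \ P') ∪ (P' \ M.erase ep),
      e ≠ ep ∧ e ∈ E ∧ w e ≤ maxW w M := by
    intro e he
    rcases Finset.mem_union.1 he with h | h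
    · obtain ⟨h1, h2⟩ := Finset.mem_erase.1 (Finset.mem_sdiff.1 h).1
      refine ⟨h1, hME h2, ?_⟩
      exact le_csSup (M.finite_toSet.image w).bddAbove ⟨e, h2, rfl⟩
    · exact hPe e (Finset.mem_sdiff.1 h).1
  refine ⟨⟨fun e he => (hall e he).2.1, hmat, fun M' h1 h2 => ?_⟩,
    fun h => (hall ep h).1 rfl, fun e he => (hall e he).2.2⟩
  have := hmax M' h1 h2
  have := Finset.pred_card_le_card_erase (s := M) (a := ep)
  omega
end
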